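/- Let q = 2^r with r ≥ 3 an integer. Set N₂ = |O⁺(2,q)| = 2(q−1), and for 0 ≤ j ≤ N₂ let C_{2,j} denote the number of codewords of Hamming weight j in the binary code C(O⁺(2,q)). Then for every integer h ≥ 1, MK^h = Σ_{l=0}^{h−1} (−1)^{h+l+1} binom(h,l) (q−1)^{h−l} MK^l + q · Σ_{j=0}^{min(N₂,h)} (−1)^{h+j} C_{2,j} Σ_{t=j}^{h} t! S(h,t) 2^{h−t} binom(N₂−j, N₂−t). -/

import Mathlib

open Finset Matrix

/-- The quadratic form `θ⁺(x) = ∑ i, x_i x_{n+i}` on `F^{2n}` (columns indexed by `Fin n ⊕ Fin n`). -/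
def thetaPlus (F : Type) [Field F] (n : ℕ) (x : Fin n ⊕ Fin n → F) : F :=
  ∑ i : Fin n, x (Sum.inl i) * x (Sum.inr i)

/-- The orthogonal group `O⁺(2n,q)`: invertible matrices preserving `θ⁺`. -/
noncomputable def OplusGrp (F : Type) [Field F] [Fintype F] [DecidableEq F] (n : ℕ) :
    Finset (Matrix (Fin n ⊕ Fin n) (Fin n ⊕ Fin n) F) := by
  classical
  exact Finset.univ.filter (fun w => IsUnit w ∧
    ∀ x : Fin n ⊕ Fin n → F, thetaPlus F n (w.mulVec x) = thetaPlus F n x)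

/-- `SO⁺(2n,q)`: the kernel of `δ⁺(w) = Tr(B ᵗC)` on `O⁺(2n,q)`,
where `w = [[A,B],[C,D]]` in `n × n` blocks. -/
noncomputable def SOplusGrp (F : Type) [Field F] [Fintype F] [DecidableEq F] (n : ℕ) :
    Finset (Matrix (Fin n ⊕ Fin n) (Fin n ⊕ Fin n) F) := by
  classical
  exact (OplusGrp F n).filter
    (fun w => Matrix.trace (Matrix.toBlocks₁₂ w * (Matrix.toBlocks₂₁ w)ᵀ) = 0)

/-- The trace map `tr(x) = x + x² + ⋯ + x^{2^{r−1}}`, valued in `𝔽₂ = {0,1} ⊆ F`. -/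
def trF (F : Type) [Field F] (r : ℕ) (x : F) : F := ∑ i ∈ Finset.range r, x ^ 2 ^ i

/-- The canonical additive character `λ(x) = (−1)^{tr(x)} ∈ {±1} ⊆ ℤ`. -/
noncomputable def lam (F : Type) [Field F] (r : ℕ) (x : F) : ℤ := by
  classical exact if trF F r x = 0 then 1 else -1

/-- The trace map `tr` viewed as a function into `𝔽₂ = ZMod 2`. -/
noncomputable def tr2 (F : Type) [Field F] (r : ℕ) (x : F) : ZMod 2 := by
  classical exact if trF F r x = 0 then 0 else 1

/-- The Kloosterman sum `K(λ;a) = ∑_{α ∈ F*} λ(α + aα⁻¹)`. -/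
noncomputable def Kl (F : Type) [Field F] [Fintype F] (r : ℕ) (a : F) : ℤ := by
  classical
  exact ∑ α ∈ Finset.univ.filter (fun α : F => α ≠ 0), lam F r (α + a * α⁻¹)

/-- The `m`-dimensional Kloosterman sum
`K_m(λ;a) = ∑_{α₁,…,α_m ∈ F*} λ(α₁ + ⋯ + α_m + aα₁⁻¹⋯α_m⁻¹)`;
for `m = 0` this is `K₀(λ;a) = λ(a)`. -/
noncomputable def Klm (F : Type) [Field F] [Fintype F] (r m : ℕ) (a : F) : ℤ := by
  classical
  exact ∑ v ∈ Finset.univ.filter (fun v : Fin m → F => ∀ i, v i ≠ 0),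
    lam F r ((∑ i, v i) + a * (∏ i, v i)⁻¹)

/-- The power moment `MK^h = ∑_{a ∈ F*} K(λ;a)^h`. -/
noncomputable def MK (F : Type) [Field F] [Fintype F] (r h : ℕ) : ℤ := by
  classical exact ∑ a ∈ Finset.univ.filter (fun a : F => a ≠ 0), (Kl F r a) ^ h

/-- The power moment `MK₂^h = ∑_{a ∈ F*} K₂(λ;a)^h` of 2-dimensional Kloosterman sums. -/
noncomputable def MK2 (F : Type) [Field F] [Fintype F] (r h : ℕ) : ℤ := by
  classical exact ∑ a ∈ Finset.univ.filter (fun a : F => a ≠ 0), (Klm F r 2 a) ^ h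

/-- The binary code `C(G) = {u ∈ 𝔽₂^G : ∑_{g ∈ G} u_g Tr(g) = 0 in F}`. -/
noncomputable def code (F : Type) [Field F] [Fintype F] [DecidableEq F]
    {ι : Type} [Fintype ι] [DecidableEq ι] (G : Finset (Matrix ι ι F)) :
    Finset (↥G → ZMod 2) := by
  classical
  exact Finset.univ.filter
    (fun u => ∑ g : ↥G, (u g).val • Matrix.trace (g : Matrix ι ι F) = 0)

/-- Number of codewords of Hamming weight `j` in the code `C(G)`. -/
noncomputable def wtCount (F : Type) [Field F] [Fintype F] [DecidableEq F]
    {ι : Type} [Fintype ι] [DecidableEq ι] (G : Finset (Matrix ι ι F)) (j : ℕ) : ℕ := by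
  classical
  exact ((code F G).filter
    (fun u => (Finset.univ.filter (fun g : ↥G => u g = 1)).card = j)).card

/-- `t! · S(h,t)` where `S(h,t)` is the Stirling number of the second kind,
`S(h,t) = (1/t!) ∑_{j=0}^{t} (−1)^{t−j} C(t,j) j^h`. -/
def tS (h t : ℕ) : ℤ :=
  ∑ j ∈ Finset.range (t + 1), (-1 : ℤ) ^ (t - j) * (t.choose j : ℤ) * (j : ℤ) ^ h

/-- Binomial coefficient with integer arguments: `0` whenever `k < 0` or `k > n`. -/
def ichoose (n k : ℤ) : ℤ := if 0 ≤ k ∧ k ≤ n then (n.toNat.choose k.toNat : ℤ) else 0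

section Trace

variable {F : Type} [Field F] {r : ℕ}

theorem trF_zero : trF F r 0 = 0 := by
  simp [trF]

theorem trF_add [CharP F 2] (x y : F) : trF F r (x + y) = trF F r x + trF F r y := by
  simp [trF, add_pow_char_pow, sum_add_distrib]

theorem lam_zero : lam F r 0 = 1 := by
  simp [lam, trF_zero]

theorem lam_eq_one_or (x : F) : lam F r x = 1 ∨ lam F r x = -1 := by
  unfold lam
  split_ifs <;> simp

variable [Fintype F]

theorem charP_two_of_card (hF : Fintype.card F = 2 ^ r) : CharP F 2 := by
  have : Fact (Nat.Prime 2) := ⟨Nat.prime_two⟩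
  exact charP_of_card_eq_prime_pow hF

theorem trF_sq (hF : Fintype.card F = 2 ^ r) (x : F) : trF F r (x ^ 2) = trF F r x := by
  have h1 : trF F r (x ^ 2) = ∑ i ∈ range r, x ^ 2 ^ (i + 1) := by
    simp only [trF, ← pow_mul, pow_succ' 2]
  have h2 := sum_range_succ' (fun i => x ^ 2 ^ i) r
  rw [sum_range_succ] at h2
  have h3 : x ^ 2 ^ r = x := by rw [← hF, FiniteField.pow_card]
  rw [h3, pow_zero, pow_one] at h2
  rw [h1, ← add_right_cancel h2, trF]

theorem trF_eq_zero_or_one [CharP F 2] (hF : Fintype.card F = 2 ^ r) (x : F) :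
    trF F r x = 0 ∨ trF F r x = 1 := by
  have : Fact (Nat.Prime 2) := ⟨Nat.prime_two⟩
  have h1 : trF F r x ^ 2 = trF F r (x ^ 2) := by
    simp only [trF, sum_pow_char, ← pow_mul, mul_comm]
  rw [trF_sq hF, sq] at h1
  rcases eq_or_ne (trF F r x) 0 with h0 | h0
  · exact Or.inl h0
  · exact Or.inr (mul_left_cancel₀ h0 (by rw [h1, mul_one]))

theorem exists_trF_ne_zero (hr : r ≠ 0) (hF : Fintype.card F = 2 ^ r) :
    ∃ x : F, trF F r x ≠ 0 := by
  classical
  by_contra! hz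
  set P : Polynomial F := ∑ i ∈ range r, Polynomial.X ^ 2 ^ i with hP
  have hdeg : P.natDegree < Fintype.card F := by
    rw [hF]
    refine lt_of_le_of_lt (Polynomial.natDegree_sum_le_of_forall_le (n := 2 ^ (r - 1)) _ _ ?_) ?_
    · intro i hi
      rw [Polynomial.natDegree_X_pow]
      exact Nat.pow_le_pow_right two_pos (by have := mem_range.1 hi; omega)
    · exact Nat.pow_lt_pow_right one_lt_two (by omega)
  have hP0 : P = 0 := by
    refine Polynomial.eq_zero_of_natDegree_lt_card_of_eval_eq_zero P
      Function.injective_id (fun x => ?_) hdeg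
    simpa [hP, Polynomial.eval_finsetSum, trF] using hz x
  have hc : P.coeff 1 = 1 := by
    rw [hP, Polynomial.finsetSum_coeff, sum_eq_single_of_mem 0 (by simp; omega)]
    · simp
    · intro i _ hi
      rw [Polynomial.coeff_X_pow, if_neg]
      exact (Nat.one_lt_two_pow hi).ne
  simp [hP0] at hc

theorem lam_add [CharP F 2] (hF : Fintype.card F = 2 ^ r) (x y : F) :
    lam F r (x + y) = lam F r x * lam F r y := by
  unfold lam
  rw [trF_add]
  rcases trF_eq_zero_or_one hF x with hx | hx <;> rcases trF_eq_zero_or_one hF y with hy | hy <;>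
    simp [hx, hy, CharTwo.add_self_eq_zero]

theorem lam_sum [CharP F 2] (hF : Fintype.card F = 2 ^ r) {ι : Type} (s : Finset ι) (f : ι → F) :
    lam F r (∑ i ∈ s, f i) = ∏ i ∈ s, lam F r (f i) := by
  classical
  induction s using Finset.induction_on with
  | empty => simp [lam_zero]
  | insert i s hi ih => rw [sum_insert hi, prod_insert hi, lam_add hF, ih]

theorem sum_lam [CharP F 2] (hr : r ≠ 0) (hF : Fintype.card F = 2 ^ r) :
    ∑ x : F, lam F r x = 0 := by
  obtain ⟨y, hy⟩ := exists_trF_ne_zero hr hF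
  have hl : lam F r y = -1 := by simp [lam, hy]
  have h := Equiv.sum_comp (Equiv.addRight y) (lam F r)
  simp only [Equiv.coe_addRight, lam_add hF, hl, ← sum_mul] at h
  linarith

theorem sum_lam_mul [DecidableEq F] [CharP F 2] (hr : r ≠ 0) (hF : Fintype.card F = 2 ^ r)
    (s : F) : ∑ a : F, lam F r (a * s) = if s = 0 then 2 ^ r else 0 := by
  split_ifs with hs
  · simp [hs, lam_zero, hF]
  · rw [← sum_lam hr hF]
    exact Equiv.sum_comp (Equiv.mulRight₀ s hs) (lam F r)

end Trace

section Pless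

theorem tS_eq_fwdDiff (h t : ℕ) :
    tS h t = (fwdDiff (1 : ℤ))^[t] (fun x : ℤ => x ^ h) 0 := by
  simp [tS, fwdDiff_iter_eq_sum_shift]

theorem pow_eq_sum_tS (h w : ℕ) :
    (w : ℤ) ^ h = ∑ t ∈ range (h + 1), tS h t * (w.choose t : ℤ) := by
  have h1 := shift_eq_sum_fwdDiff_iter (1 : ℤ) (fun x : ℤ => x ^ h) w 0
  simp only [zero_add, nsmul_eq_mul, mul_one, ← tS_eq_fwdDiff] at h1
  rw [h1]
  have key : ∀ n, w ≤ n → h ≤ n → ∀ m ∈ ({w, h} : Finset ℕ),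
      ∑ t ∈ range (m + 1), tS h t * (w.choose t : ℤ) =
        ∑ t ∈ range (n + 1), tS h t * (w.choose t : ℤ) := by
    intro n hw hh m hm
    have hm' : m = w ∨ m = h := by simpa using hm
    refine sum_subset (by intro x; simp only [mem_range]; omega) fun t _ ht => ?_
    have ht' : m < t := by simpa using ht
    rcases hm' with rfl | rfl
    · simp [Nat.choose_eq_zero_of_lt ht']
    · rw [tS_eq_fwdDiff, fwdDiff_iter_pow_eq_zero_of_lt ht', Pi.zero_apply, zero_mul]
  rw [key (max w h) (le_max_left _ _) (le_max_right _ _) h (by simp),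
    ← key (max w h) (le_max_left _ _) (le_max_right _ _) w (by simp)]
  exact sum_congr rfl fun _ _ => mul_comm _ _

variable {X : Type} [Fintype X]

theorem card_sub_sum_eq (f : X → ℤ) (hf : ∀ x, f x = 1 ∨ f x = -1) :
    (Fintype.card X : ℤ) - ∑ x, f x = 2 * ((univ.filter (fun x => f x = -1)).card : ℤ) := by
  rw [card_filter, Nat.cast_sum, mul_sum, ← card_univ, card_eq_sum_ones, Nat.cast_sum,
    ← sum_sub_distrib]
  refine sum_congr rfl fun x _ => ?_
  rcases hf x with h | h <;> simp [h]

variable [DecidableEq X]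

theorem card_powersetCard_filter_superset (U : Finset X) (t : ℕ) :
    ((((powersetCard t (univ : Finset X)).filter (U ⊆ ·)).card : ℕ) : ℤ) =
      ichoose ((Fintype.card X : ℤ) - U.card) ((Fintype.card X : ℤ) - t) := by
  have hU : U.card ≤ Fintype.card X := card_le_univ U
  unfold ichoose
  split_ifs with hc
  · have e1 : ((Fintype.card X : ℤ) - U.card).toNat = Fintype.card X - U.card := by omega
    have e2 : ((Fintype.card X : ℤ) - t).toNat = Fintype.card X - t := by omega
    rw [e1, e2, ← card_compl, ← card_powersetCard]
    norm_cast
    refine card_bij' (fun T _ => Tᶜ) (fun T _ => Tᶜ) ?_ ?_ (by simp) (by simp)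
    · intro T hT
      simp only [mem_filter, mem_powersetCard, subset_univ, true_and] at hT
      simp only [mem_powersetCard, compl_subset_compl]
      exact ⟨hT.2, by rw [card_compl, hT.1]⟩
    · intro T hT
      rw [mem_powersetCard] at hT
      simp only [mem_filter, mem_powersetCard, subset_univ, true_and]
      refine ⟨by rw [card_compl, hT.2]; omega, ?_⟩
      rw [← compl_subset_compl, compl_compl]
      exact hT.1
  · rw [Nat.cast_eq_zero, card_eq_zero, filter_eq_empty_iff]
    intro T hT hUT
    have h1 := (mem_powersetCard.1 hT).2
    have h2 := card_le_card hUT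
    have h3 := card_le_univ T
    omega

theorem two_pow_mul_choose_card (f : X → ℤ) (hf : ∀ x, f x = 1 ∨ f x = -1) (t : ℕ) :
    (2 : ℤ) ^ t * ((univ.filter (fun x => f x = -1)).card.choose t : ℤ) =
      ∑ U : Finset X, (-1) ^ U.card * (∏ x ∈ U, f x) *
        ichoose ((Fintype.card X : ℤ) - U.card) ((Fintype.card X : ℤ) - t) := by
  have h1 : (2 : ℤ) ^ t * ((univ.filter (fun x => f x = -1)).card.choose t : ℤ) =
      ∑ T ∈ powersetCard t (univ : Finset X), ∏ x ∈ T, (1 + -f x) := by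
    have h2 : powersetCard t (univ.filter (fun x => f x = -1)) ⊆
        powersetCard t (univ : Finset X) := powersetCard_mono (subset_univ _)
    rw [← sum_subset h2, sum_congr rfl (g := fun _ => (2 : ℤ) ^ t)]
    · rw [sum_const, card_powersetCard, nsmul_eq_mul, mul_comm]
    · intro T hT
      rw [mem_powersetCard] at hT
      rw [← hT.2]
      refine prod_eq_pow_card fun x hx => ?_
      rw [(mem_filter.1 (hT.1 hx)).2]
      norm_num
    · intro T hT hT'
      have hns : ¬ T ⊆ univ.filter (fun x => f x = -1) := fun hs =>
        hT' (mem_powersetCard.2 ⟨hs, (mem_powersetCard.1 hT).2⟩)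
      obtain ⟨x, hx, hx'⟩ := not_subset.1 hns
      refine prod_eq_zero hx ?_
      rw [(hf x).resolve_right (by simpa using hx')]
      norm_num
  rw [h1]
  simp only [prod_one_add, prod_neg, ← card_powersetCard_filter_superset, card_filter, Nat.cast_sum,
    mul_sum]
  rw [sum_comm]
  refine sum_congr rfl fun T _ => ?_
  rw [← sum_subset (subset_univ T.powerset)]
  · refine sum_congr rfl fun U hU => ?_
    simp [mem_powerset.1 hU]
  · intro U _ hU
    simp [mt mem_powerset.2 hU]

variable {F : Type} [Field F] [Fintype F] [DecidableEq F] [CharP F 2] {r : ℕ}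

theorem sum_card_sub_sum_lam_pow (hr : r ≠ 0) (hF : Fintype.card F = 2 ^ r) (τ : X → F) (h : ℕ) :
    ∑ a : F, ((Fintype.card X : ℤ) - ∑ x, lam F r (a * τ x)) ^ h =
      2 ^ r * ∑ j ∈ range (min (Fintype.card X) h + 1),
        (-1 : ℤ) ^ j *
          ((univ.filter (fun U : Finset X => ∑ x ∈ U, τ x = 0 ∧ U.card = j)).card : ℤ) *
          ∑ t ∈ Icc j h, tS h t * 2 ^ (h - t) *
            ichoose ((Fintype.card X : ℤ) - j) ((Fintype.card X : ℤ) - t) := by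
  set N : ℤ := (Fintype.card X : ℤ) with hN
  set g : ℕ → ℤ := fun j => ∑ t ∈ Icc j h, tS h t * 2 ^ (h - t) * ichoose (N - j) (N - t) with hg
  have hg' : ∀ j : ℕ, ∑ t ∈ range (h + 1), tS h t * 2 ^ (h - t) * ichoose (N - j) (N - t) =
      g j := by
    intro j
    refine (sum_subset (fun t ht => ?_) fun t ht ht' => ?_).symm
    · have := mem_Icc.1 ht
      exact mem_range.2 (by omega)
    · have h1 := mem_range.1 ht
      have h2 : ¬ (j ≤ t ∧ t ≤ h) := fun h3 => ht' (mem_Icc.2 h3)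
      rw [ichoose, if_neg (by omega), mul_zero]
  have h1 : ∀ a : F, (N - ∑ x, lam F r (a * τ x)) ^ h =
      ∑ U : Finset X, (-1) ^ U.card * lam F r (a * ∑ x ∈ U, τ x) * g U.card := by
    intro a
    have hf : ∀ x, lam F r (a * τ x) = 1 ∨ lam F r (a * τ x) = -1 := fun x => lam_eq_one_or _
    rw [hN, card_sub_sum_eq _ hf, mul_pow, pow_eq_sum_tS, mul_sum]
    simp only [← hg', mul_sum]
    rw [sum_comm]
    refine sum_congr rfl fun t ht => ?_
    have hth : t ≤ h := by have := mem_range.1 ht; omega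
    calc (2 : ℤ) ^ h * (tS h t * _) = tS h t * 2 ^ (h - t) * (2 ^ t *
          ((univ.filter (fun x => lam F r (a * τ x) = -1)).card.choose t : ℤ)) := by
          rw [← pow_sub_mul_pow (2 : ℤ) hth]; ring
      _ = _ := by
          rw [two_pow_mul_choose_card _ hf, mul_sum]
          refine sum_congr rfl fun U _ => ?_
          rw [lam_sum hF]
          ring
  simp only [h1]
  rw [sum_comm]
  have h2 : ∀ U : Finset X,
      ∑ a : F, (-1) ^ U.card * lam F r (a * ∑ x ∈ U, τ x) * g U.card =
        2 ^ r * (if ∑ x ∈ U, τ x = 0 then (-1) ^ U.card * g U.card else 0) := by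
    intro U
    rw [← sum_mul, ← mul_sum, sum_lam_mul hr hF]
    split_ifs <;> ring
  simp only [h2, ← mul_sum]
  congr 1
  rw [← sum_filter, ← sum_filter_of_ne (p := fun U => U.card ≤ h), filter_filter,
    ← sum_fiberwise_of_maps_to (g := card) (t := range (min (Fintype.card X) h + 1))]
  · refine sum_congr rfl fun j hj => ?_
    rw [sum_congr rfl (g := fun _ => (-1) ^ j * g j), sum_const, nsmul_eq_mul]
    · rw [filter_filter]
      have : (univ.filter fun U : Finset X => (∑ x ∈ U, τ x = 0 ∧ U.card ≤ h) ∧ U.card = j) =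
          univ.filter fun U : Finset X => ∑ x ∈ U, τ x = 0 ∧ U.card = j := by
        have hjh := (Nat.le_of_lt_succ (mem_range.1 hj)).trans (min_le_right _ _)
        exact filter_congr fun U _ => ⟨fun hU => ⟨hU.1.1, hU.2⟩,
          fun hU => ⟨⟨hU.1, hU.2.le.trans hjh⟩, hU.2⟩⟩
      rw [this]
      ring
    · intro U hU
      rw [(mem_filter.1 hU).2]
  · intro U hU
    have h3 := (mem_filter.1 hU).2.2
    have h4 := card_le_univ U
    exact mem_range.2 (Nat.lt_succ_of_le (le_min h4 h3))
  · intro U _ hne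
    by_contra hlt
    exact hne (by simp [hg, Icc_eq_empty hlt])

end Pless

section Orthogonal

variable {F : Type} [Field F]

/-- The elements of `O⁺(2,q)`: diagonal matrices `diag(u, u⁻¹)` and their antidiagonal analogues. -/
def oplusElt : Fˣ ⊕ Fˣ → Matrix (Fin 1 ⊕ Fin 1) (Fin 1 ⊕ Fin 1) F
  | Sum.inl u => fromBlocks (fun _ _ => (u : F)) 0 0 (fun _ _ => ((u⁻¹ : Fˣ) : F))
  | Sum.inr u => fromBlocks 0 (fun _ _ => (u : F)) (fun _ _ => ((u⁻¹ : Fˣ) : F)) 0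

theorem trace_oplusElt_inl (u : Fˣ) :
    trace (oplusElt (Sum.inl u)) = (u : F) + ((u⁻¹ : Fˣ) : F) := by
  simp [oplusElt, fromBlocks, trace]

theorem trace_oplusElt_inr (u : Fˣ) : trace (oplusElt (Sum.inr u) : Matrix _ _ F) = 0 := by
  simp [oplusElt, fromBlocks, trace]

theorem oplusElt_injective : Function.Injective (oplusElt (F := F)) := by
  rintro (u | u) (v | v) huv
  · have h1 := congrFun (congrFun huv (Sum.inl 0)) (Sum.inl 0)
    simpa [oplusElt, fromBlocks, Units.ext_iff] using h1
  · have h1 := congrFun (congrFun huv (Sum.inl 0)) (Sum.inl 0)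
    simp [oplusElt, fromBlocks] at h1
  · have h1 := congrFun (congrFun huv (Sum.inl 0)) (Sum.inl 0)
    simp [oplusElt, fromBlocks] at h1
    exact absurd h1.symm v.ne_zero
  · have h1 := congrFun (congrFun huv (Sum.inl 0)) (Sum.inr 0)
    simpa [oplusElt, fromBlocks, Units.ext_iff] using h1

theorem isUnit_oplusElt (x : Fˣ ⊕ Fˣ) : IsUnit (oplusElt x) := by
  rcases x with u | u
  · refine IsUnit.of_mul_eq_one (oplusElt (Sum.inl u⁻¹)) ?_
    ext i j
    rcases i with i | i <;> rcases j with j | j <;> fin_cases i <;> fin_cases j <;>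
      simp [oplusElt, fromBlocks, Matrix.mul_apply]
  · refine IsUnit.of_mul_eq_one (oplusElt (Sum.inr u)) ?_
    ext i j
    rcases i with i | i <;> rcases j with j | j <;> fin_cases i <;> fin_cases j <;>
      simp [oplusElt, fromBlocks, Matrix.mul_apply]

variable [Fintype F]

theorem bijective_units_sq [CharP F 2] : Function.Bijective (fun u : Fˣ => u ^ 2) := by
  rw [← Finite.injective_iff_bijective]
  intro u v huv
  have h1 : (u : F) ^ 2 = (v : F) ^ 2 := by exact_mod_cast congrArg Units.val huv
  have h2 : ((u : F) + v) ^ 2 = 0 := by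
    rw [CharTwo.add_sq, h1, CharTwo.add_self_eq_zero]
  exact Units.ext (CharTwo.add_eq_zero.1 (pow_eq_zero_iff two_ne_zero |>.1 h2))

variable {r : ℕ}

variable [DecidableEq F]

theorem sum_filter_ne_zero_eq_sum_units (f : F → ℤ) :
    ∑ α ∈ univ.filter (fun α : F => α ≠ 0), f α = ∑ u : Fˣ, f u :=
  sum_bij' (fun α hα => Units.mk0 α (mem_filter.1 hα).2) (fun u _ => (u : F))
    (by simp) (by simp) (by simp) (by simp) (by simp)

theorem Kl_eq_sum_units (a : F) : Kl F r a = ∑ u : Fˣ, lam F r (u + a * ((u⁻¹ : Fˣ) : F)) := by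
  rw [Kl]
  convert sum_filter_ne_zero_eq_sum_units (fun α => lam F r (α + a * α⁻¹))
  rw [Units.val_inv_eq_inv_val]

theorem MK_eq_sum_units (h : ℕ) : MK F r h = ∑ u : Fˣ, Kl F r (u : F) ^ h := by
  rw [MK]
  convert sum_filter_ne_zero_eq_sum_units (fun α => Kl F r α ^ h)

theorem oplusElt_mem (x : Fˣ ⊕ Fˣ) : oplusElt x ∈ OplusGrp F 1 := by
  rw [OplusGrp, mem_filter]
  refine ⟨mem_univ _, isUnit_oplusElt x, fun v => ?_⟩
  rcases x with u | u
  · simp [thetaPlus, oplusElt, fromBlocks, mulVec, dotProduct]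
    field_simp
  · simp [thetaPlus, oplusElt, fromBlocks, mulVec, dotProduct]
    field_simp

theorem exists_oplusElt_eq {w : Matrix (Fin 1 ⊕ Fin 1) (Fin 1 ⊕ Fin 1) F}
    (hw : w ∈ OplusGrp F 1) : ∃ x, oplusElt x = w := by
  rw [OplusGrp, mem_filter] at hw
  have hθ := hw.2.2
  have h1 := hθ (Sum.elim 1 0)
  have h2 := hθ (Sum.elim 0 1)
  have h3 := hθ (Sum.elim 1 1)
  simp [thetaPlus, mulVec, dotProduct] at h1 h2 h3
  set a := w (Sum.inl 0) (Sum.inl 0) with ha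
  set b := w (Sum.inl 0) (Sum.inr 0) with hb
  set c := w (Sum.inr 0) (Sum.inl 0) with hc
  set d := w (Sum.inr 0) (Sum.inr 0) with hd
  by_cases ha0 : a = 0
  · have hbc : b * c = 1 := by
      rcases h2 with h2 | h2
      · simp [ha0, h2] at h3
      · simpa [ha0, h2] using h3
    have hd0 : d = 0 := h2.resolve_left (left_ne_zero_of_mul_eq_one hbc)
    refine ⟨Sum.inr ⟨b, c, hbc, by rw [mul_comm, hbc]⟩, ?_⟩
    ext i j
    rcases i with i | i <;> rcases j with j | j <;> fin_cases i <;> fin_cases j <;>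
      simp [oplusElt, fromBlocks, ← ha, ← hb, ← hc, ← hd, ha0, hd0]
  · have hc0 : c = 0 := h1.resolve_left ha0
    have hab : (a + b) * d = 1 := by simpa [hc0] using h3
    have hb0 : b = 0 := h2.resolve_right (right_ne_zero_of_mul_eq_one hab)
    have had : a * d = 1 := by simpa [hb0] using hab
    refine ⟨Sum.inl ⟨a, d, had, by rw [mul_comm, had]⟩, ?_⟩
    ext i j
    rcases i with i | i <;> rcases j with j | j <;> fin_cases i <;> fin_cases j <;>
      simp [oplusElt, fromBlocks, ← ha, ← hb, ← hc, ← hd, hb0, hc0]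

variable (F) in
/-- The parametrization of `O⁺(2,q)` by two copies of `Fˣ`. -/
noncomputable def oplusEquiv : Fˣ ⊕ Fˣ ≃ OplusGrp F 1 :=
  Equiv.ofBijective (fun x => ⟨oplusElt x, oplusElt_mem x⟩)
    ⟨fun _ _ hxy => oplusElt_injective (Subtype.ext_iff.1 hxy), fun w => by
      obtain ⟨x, hx⟩ := exists_oplusElt_eq w.2
      exact ⟨x, Subtype.ext hx⟩⟩

variable (F) in
theorem card_OplusGrp_one : (OplusGrp F 1).card = 2 * (Fintype.card F - 1) := by
  rw [← Fintype.card_coe, ← Fintype.card_congr (oplusEquiv F), Fintype.card_sum,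
    Fintype.card_units, two_mul]

theorem wtCount_eq [CharP F 2] {ι : Type} [Fintype ι] [DecidableEq ι]
    (G : Finset (Matrix ι ι F)) (j : ℕ) :
    wtCount F G j = (univ.filter (fun U : Finset G =>
      ∑ g ∈ U, trace (g : Matrix ι ι F) = 0 ∧ U.card = j)).card := by
  classical
  have hval : ∀ z : ZMod 2, z.val = if z = 1 then 1 else 0 := by decide
  rw [wtCount]
  refine card_bij' (fun u _ => univ.filter (fun g => u g = 1))
    (fun U _ g => if g ∈ U then 1 else 0) ?_ ?_ ?_ ?_
  · intro u hu
    rw [mem_filter, code, mem_filter] at hu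
    refine mem_filter.2 ⟨mem_univ _, ?_, hu.2⟩
    rw [sum_filter]
    refine Eq.trans (sum_congr rfl fun g _ => ?_) hu.1.2
    rw [hval]
    split_ifs <;> simp
  · intro U hU
    have hU' := (mem_filter.1 hU).2
    rw [mem_filter, code, mem_filter]
    refine ⟨⟨mem_univ _, ?_⟩, ?_⟩
    · refine Eq.trans (Eq.trans (sum_congr rfl fun g _ => ?_)
        (sum_ite_mem univ U fun g => trace (g : Matrix ι ι F))) ?_
      · rw [hval]
        split_ifs <;> simp_all
      · rw [univ_inter, hU'.1]
    · rw [← hU'.2]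
      congr 1
      ext g
      simp
  · intro u _
    funext g
    have : ∀ z : ZMod 2, (if z = 1 then 1 else 0) = z := by decide
    simpa using this (u g)
  · intro U _
    ext g
    simp

theorem sum_lam_trace [CharP F 2] (hF : Fintype.card F = 2 ^ r) (a : Fˣ) :
    ∑ g : OplusGrp F 1, lam F r (a * trace (g : Matrix (Fin 1 ⊕ Fin 1) (Fin 1 ⊕ Fin 1) F)) =
      Kl F r ((a : F) ^ 2) + (2 ^ r - 1) := by
  rw [← Equiv.sum_comp (oplusEquiv F), Fintype.sum_sum_type]
  have hl : ∀ u, ((oplusEquiv F u : OplusGrp F 1) : Matrix _ _ F) = oplusElt u := fun _ => rfl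
  simp only [hl, trace_oplusElt_inl, trace_oplusElt_inr, mul_zero, lam_zero]
  congr 1
  · rw [Kl_eq_sum_units]
    refine Eq.trans (sum_congr rfl fun u _ => ?_) (Equiv.sum_comp (Equiv.mulLeft a) _)
    congr 1
    simp
    field_simp
  · rw [sum_const, card_univ, Fintype.card_units, hF, nsmul_eq_mul, mul_one,
      Nat.cast_sub Nat.one_le_two_pow]
    simp

theorem sum_card_sub_sum_lam_trace_pow [CharP F 2] (hF : Fintype.card F = 2 ^ r) {h : ℕ}
    (hh : h ≠ 0) :
    ∑ a : F, ((Fintype.card (OplusGrp F 1) : ℤ) - ∑ g : OplusGrp F 1,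
        lam F r (a * trace (g : Matrix (Fin 1 ⊕ Fin 1) (Fin 1 ⊕ Fin 1) F))) ^ h =
      ∑ u : Fˣ, ((2 ^ r - 1) - Kl F r (u : F)) ^ h := by
  have hN : (Fintype.card (OplusGrp F 1) : ℤ) = 2 * (2 ^ r - 1) := by
    rw [Fintype.card_coe, card_OplusGrp_one, hF, Nat.cast_mul, Nat.cast_sub Nat.one_le_two_pow]
    simp
  rw [← Equiv.sum_comp (Equiv.ofBijective _ (bijective_units_sq (F := F)))]
  rw [← sum_filter_add_sum_filter_not univ (fun a : F => a ≠ 0),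
    sum_filter_ne_zero_eq_sum_units, sum_eq_zero (s := univ.filter fun a : F => ¬a ≠ 0), add_zero]
  · refine sum_congr rfl fun u _ => ?_
    rw [sum_lam_trace hF, hN]
    simp only [Equiv.ofBijective_apply, Units.val_pow_eq_pow_val]
    ring
  · intro a ha
    have ha0 : a = 0 := not_not.1 (mem_filter.1 ha).2
    simp [ha0, lam_zero, hh]

end Orthogonal

theorem stmt1 (r : ℕ) (hr : 3 ≤ r) (F : Type) [Field F] [Fintype F] [DecidableEq F]
    (hF : Fintype.card F = 2 ^ r) (N₂ : ℕ) (hN₂ : N₂ = 2 * (2 ^ r - 1))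
    (h : ℕ) (hh : 1 ≤ h) :
    (OplusGrp F 1).card = N₂ ∧
    MK F r h =
      (∑ l ∈ Finset.range h,
        (-1 : ℤ) ^ (h + l + 1) * (h.choose l : ℤ) * ((2 ^ r : ℤ) - 1) ^ (h - l) * MK F r l) +
      (2 ^ r : ℤ) *
        ∑ j ∈ Finset.range (min N₂ h + 1),
          (-1 : ℤ) ^ (h + j) * (wtCount F (OplusGrp F 1) j : ℤ) *
            ∑ t ∈ Finset.Icc j h,
              tS h t * 2 ^ (h - t) * ichoose ((N₂ : ℤ) - (j : ℤ)) ((N₂ : ℤ) - (t : ℤ)) := by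
  have hr : r ≠ 0 := by omega
  have : CharP F 2 := charP_two_of_card hF
  have hcard : (OplusGrp F 1).card = N₂ := by rw [card_OplusGrp_one, hF, hN₂]
  refine ⟨hcard, ?_⟩
  have key := sum_card_sub_sum_lam_pow hr hF
    (fun g : OplusGrp F 1 => trace (g : Matrix (Fin 1 ⊕ Fin 1) (Fin 1 ⊕ Fin 1) F)) h
  rw [sum_card_sub_sum_lam_trace_pow hF (by omega)] at key
  simp only [Fintype.card_coe, hcard, ← wtCount_eq] at key
  have hsplit : ∑ u : Fˣ, ((2 ^ r - 1) - Kl F r (u : F)) ^ h =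
      ∑ l ∈ range (h + 1), (-1 : ℤ) ^ l * (h.choose l : ℤ) * ((2 ^ r : ℤ) - 1) ^ (h - l) *
        MK F r l := by
    simp only [MK_eq_sum_units, mul_sum]
    rw [sum_comm]
    refine sum_congr rfl fun u _ => ?_
    rw [sub_eq_neg_add, add_pow]
    refine sum_congr rfl fun l _ => ?_
    rw [neg_pow]
    ring
  have hmoment : MK F r h = (-1 : ℤ) ^ h * ∑ u : Fˣ, ((2 ^ r - 1) - Kl F r (u : F)) ^ h +
      ∑ l ∈ range h, (-1 : ℤ) ^ (h + l + 1) * (h.choose l : ℤ) * ((2 ^ r : ℤ) - 1) ^ (h - l) *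
        MK F r l := by
    have hs : (-1 : ℤ) ^ h * (-1) ^ h = 1 := by rw [← mul_pow]; simp
    rw [hsplit, sum_range_succ, mul_add, mul_sum, add_right_comm, ← sum_add_distrib]
    rw [sum_eq_zero fun l _ => by ring]
    simp only [Nat.choose_self, Nat.sub_self, pow_zero, Nat.cast_one, mul_one, zero_add]
    rw [← mul_assoc, hs, one_mul]
  rw [hmoment, add_comm, key, mul_left_comm, mul_sum]
  congr 2
  refine sum_congr rfl fun j _ => ?_
  ring
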